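/- arXiv:2011.00807 — 2 statements merged into one kernel-verified Lean document; each statement's English description precedes it below -/
import Mathlib

section
/- Let A ⊂ [0,∞) be measurable with μ(A) = ∞ and suppose W(∞) = ∫₀^∞ ω(s) ds < ∞. Then the Orlicz norm of the characteristic function of A in the Orlicz–Lorentz space satisfies ‖χ_A‖°_{φ,ω} = ψ⁻¹(1/W(∞)) · W(∞), where ψ⁻¹ is the inverse of the complementary function ψ. -/
open MeasureTheory Set Filter Topology
open scoped ENNReal

noncomputable section

/-- An Orlicz function: convex, even, vanishing only at `0`, with
`φ(u)/u → 0` as `u → 0⁺` and `φ(u)/u → ∞` as `u → ∞`. -/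
def IsOrliczFunction (φ : ℝ → ℝ) : Prop :=
  ConvexOn ℝ Set.univ φ ∧ (∀ u, φ (-u) = φ u) ∧ φ 0 = 0 ∧
    (∀ u : ℝ, 0 < u → 0 < φ u) ∧ (∀ u : ℝ, 0 ≤ φ u) ∧
    Filter.Tendsto (fun u => φ u / u) (nhdsWithin 0 (Set.Ioi 0)) (nhds 0) ∧
    Filter.Tendsto (fun u => φ u / u) Filter.atTop Filter.atTop

/-- The complementary (conjugate) Orlicz function `ψ(v) = sup_{u>0} (|uv| - φ(u))`. -/
def complementaryFn (φ : ℝ → ℝ) (v : ℝ) : ℝ :=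
  sSup {w | ∃ u : ℝ, 0 < u ∧ w = |u * v| - φ u}

/-- The `Δ₂` condition for all values. -/
def Delta2All (φ : ℝ → ℝ) : Prop :=
  ∃ K : ℝ, 0 < K ∧ ∀ u : ℝ, φ (2 * u) ≤ K * φ u

/-- The `Δ₂` condition for large values. -/
def Delta2Large (φ : ℝ → ℝ) : Prop :=
  ∃ K : ℝ, 0 < K ∧ ∃ u₀ : ℝ, 0 ≤ u₀ ∧ ∀ u : ℝ, u₀ ≤ u → φ (2 * u) ≤ K * φ u

/-- The interval `[0, γ)` viewed inside `ℝ`, where `γ ≤ ∞`. -/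
def domSet (γ : ℝ≥0∞) : Set ℝ := {s : ℝ | 0 ≤ s ∧ (ENNReal.ofReal s) < γ}

/-- The decreasing rearrangement of `x` (with underlying domain `D`):
`x*(t) = inf {θ > 0 : μ{s ∈ D : |x(s)| > θ} ≤ t}`. -/
def rearr (D : Set ℝ) (x : ℝ → ℝ) (t : ℝ) : ℝ :=
  sInf {θ : ℝ | 0 < θ ∧ volume {s ∈ D | θ < |x s|} ≤ ENNReal.ofReal t}

/-- A weight function on `D`: non-increasing, non-negative and locally integrable. -/
def IsWeight (D : Set ℝ) (ω : ℝ → ℝ) : Prop :=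
  (∀ t ∈ D, 0 ≤ ω t) ∧ AntitoneOn ω D ∧
    ∀ t : ℝ, IntegrableOn ω (D ∩ Set.Icc 0 t) volume

/-- The modular `ρ_{φ,ω}(x) = ∫_D φ(x*(t)) ω(t) dt`. -/
def olModular (D : Set ℝ) (φ ω x : ℝ → ℝ) : ℝ≥0∞ :=
  ∫⁻ t in D, ENNReal.ofReal (φ (rearr D x t) * ω t)

/-- Membership in the Orlicz–Lorentz space `Λ_{φ,ω}`. -/
def MemOL (D : Set ℝ) (φ ω x : ℝ → ℝ) : Prop :=
  Measurable x ∧ ∃ l : ℝ, 0 < l ∧ olModular D φ ω (fun t => l * x t) < ⊤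

/-- The Orlicz (Amemiya) norm `‖x‖° = inf_{k>0} (1 + ρ_{φ,ω}(kx))/k`. -/
def orliczNorm (D : Set ℝ) (φ ω x : ℝ → ℝ) : ℝ≥0∞ :=
  ⨅ k ∈ Set.Ioi (0:ℝ), (1 + olModular D φ ω (fun t => k * x t)) / ENNReal.ofReal k

/-- The Luxemburg norm `‖x‖ = inf {ε > 0 : ρ_{φ,ω}(x/ε) ≤ 1}`. -/
def luxNorm (D : Set ℝ) (φ ω x : ℝ → ℝ) : ℝ :=
  sInf {ε : ℝ | 0 < ε ∧ olModular D φ ω (fun t => x t / ε) ≤ 1}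

/-- `K(x) = {k > 0 : ‖x‖° = (1 + ρ_{φ,ω}(kx))/k}`. -/
def KSet (D : Set ℝ) (φ ω x : ℝ → ℝ) : Set ℝ :=
  {k : ℝ | 0 < k ∧
    orliczNorm D φ ω x = (1 + olModular D φ ω (fun t => k * x t)) / ENNReal.ofReal k}

/-- The Lorentz norm `‖x‖_{1,ω} = ∫_D x*(t) ω(t) dt`. -/
def lorentzNorm (D : Set ℝ) (ω x : ℝ → ℝ) : ℝ≥0∞ :=
  ∫⁻ t in D, ENNReal.ofReal (rearr D x t * ω t)

/-- The (generalized right-continuous) inverse of an Orlicz function. -/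
def orliczInv (ψ : ℝ → ℝ) (v : ℝ) : ℝ :=
  sSup {u : ℝ | 0 ≤ u ∧ ψ u ≤ v}

/-- The right derivative of `φ`, as the infimum of right slopes. -/
def rightDerivOf (φ : ℝ → ℝ) (u : ℝ) : ℝ :=
  sInf {r : ℝ | ∃ v : ℝ, u < v ∧ r = (φ v - φ u) / (v - u)}

/-- The set whose supremum defines the complementary function is bounded above. -/
theorem IsOrliczFunction.bddAbove_complementaryFn {φ : ℝ → ℝ} (hφ : IsOrliczFunction φ)
    {v : ℝ} (hv : 0 ≤ v) : BddAbove {w | ∃ u : ℝ, 0 < u ∧ w = |u * v| - φ u} := by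
  obtain ⟨-, -, -, -, hnonneg, -, htop⟩ := hφ
  obtain ⟨N, hN⟩ := eventually_atTop.1 (htop.eventually_ge_atTop v)
  refine ⟨|N| * v, ?_⟩
  rintro w ⟨u, hu, rfl⟩
  rw [abs_of_nonneg (mul_nonneg hu.le hv)]
  rcases le_total N u with h | h
  · have h1 := hN u h
    rw [le_div_iff₀ hu] at h1
    nlinarith [mul_nonneg (abs_nonneg N) hv]
  · nlinarith [hnonneg u, mul_le_mul_of_nonneg_right (h.trans (le_abs_self N)) hv]

theorem IsOrliczFunction.complementaryFn_le_iff {φ : ℝ → ℝ} (hφ : IsOrliczFunction φ)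
    {v : ℝ} (hv : 0 ≤ v) (c : ℝ) :
    complementaryFn φ v ≤ c ↔ ∀ u : ℝ, 0 < u → u * v - φ u ≤ c := by
  rw [complementaryFn,
    csSup_le_iff (hφ.bddAbove_complementaryFn hv) ⟨_, 1, one_pos, rfl⟩]
  constructor
  · intro h u hu
    simpa [abs_of_nonneg (mul_nonneg hu.le hv)] using h _ ⟨u, hu, rfl⟩
  · rintro h w ⟨u, hu, rfl⟩
    simpa [abs_of_nonneg (mul_nonneg hu.le hv)] using h u hu

theorem rearr_mul_indicator_of_volume_eq_top {D A : Set ℝ} (hA : A ⊆ D) (hvol : volume A = ⊤)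
    {k : ℝ} (hk : 0 < k) (t : ℝ) :
    rearr D (fun s => k * A.indicator (fun _ => (1 : ℝ)) s) t = k := by
  have hset : {θ : ℝ | 0 < θ ∧
      volume {s ∈ D | θ < |k * A.indicator (fun _ => (1 : ℝ)) s|} ≤ ENNReal.ofReal t} =
      Set.Ici k := by
    ext θ
    simp only [mem_ofPred_eq, mem_Ici]
    constructor
    · rintro ⟨-, hle⟩
      by_contra! hlt
      have hsub : A ⊆ {s ∈ D | θ < |k * A.indicator (fun _ => (1 : ℝ)) s|} := fun s hs =>
        ⟨hA hs, by simpa [indicator_of_mem hs, abs_of_pos hk] using hlt⟩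
      have := (measure_mono hsub).trans hle
      rw [hvol] at this
      exact ENNReal.ofReal_ne_top (top_le_iff.1 this)
    · intro hle
      have hempty : {s ∈ D | θ < |k * A.indicator (fun _ => (1 : ℝ)) s|} = ∅ := by
        refine eq_empty_of_forall_notMem fun s hs => ?_
        have h2 := hs.2
        by_cases hsA : s ∈ A
        · simp [hsA, abs_of_pos hk] at h2
          linarith
        · simp [hsA] at h2
          linarith
      exact ⟨hk.trans_le hle, by rw [hempty, measure_empty]; exact zero_le⟩
  rw [rearr, hset, csInf_Ici]

theorem olModular_mul_indicator_of_volume_eq_top {D A : Set ℝ} {φ ω : ℝ → ℝ}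
    (hφ : ∀ u, 0 ≤ φ u) (hD : MeasurableSet D) (hω : ∀ t ∈ D, 0 ≤ ω t)
    (hW : IntegrableOn ω D) (hA : A ⊆ D) (hvol : volume A = ⊤) {k : ℝ} (hk : 0 < k) :
    olModular D φ ω (fun s => k * A.indicator (fun _ => (1 : ℝ)) s) =
      ENNReal.ofReal (φ k * ∫ s in D, ω s) := by
  simp only [olModular, rearr_mul_indicator_of_volume_eq_top hA hvol hk]
  rw [← integral_const_mul, ofReal_integral_eq_lintegral_ofReal (hW.const_mul _)]
  filter_upwards [ae_restrict_mem hD] with t ht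
  exact mul_nonneg (hφ k) (hω t ht)

/-- For measurable `A ⊆ [0,∞)` with `μ(A) = ∞` and
`W(∞) = ∫₀^∞ ω(s) ds < ∞`, `‖χ_A‖°_{φ,ω} = ψ⁻¹(1/W(∞))·W(∞)`. -/
theorem orliczNorm_indicator_infinite_measure
    (φ ω : ℝ → ℝ) (hφ : IsOrliczFunction φ) (hω : IsWeight (Set.Ici 0) ω)
    (A : Set ℝ) (hA : A ⊆ Set.Ici 0) (hAm : MeasurableSet A)
    (hvol : volume A = ⊤) (hW : IntegrableOn ω (Set.Ici 0) volume) :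
    orliczNorm (Set.Ici 0) φ ω (A.indicator fun _ => (1:ℝ)) =
      ENNReal.ofReal
        (orliczInv (complementaryFn φ) (1 / ∫ s in Set.Ici (0:ℝ), ω s) *
          ∫ s in Set.Ici (0:ℝ), ω s) := by
  have hnonneg : ∀ u, 0 ≤ φ u := hφ.2.2.2.2.1
  have hmod := fun (k : ℝ) (hk : 0 < k) => olModular_mul_indicator_of_volume_eq_top hnonneg
    measurableSet_Ici hω.1 hW hA hvol hk
  have hW0 : 0 ≤ ∫ s in Set.Ici (0:ℝ), ω s := setIntegral_nonneg measurableSet_Ici hω.1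
  set W := ∫ s in Set.Ici (0:ℝ), ω s
  have hnorm : orliczNorm (Set.Ici 0) φ ω (A.indicator fun _ => (1:ℝ)) =
      ⨅ k ∈ Set.Ioi (0:ℝ), ENNReal.ofReal ((1 + φ k * W) / k) := by
    refine iInf_congr fun k => iInf_congr fun hk => ?_
    rw [hmod k hk, ENNReal.ofReal_div_of_pos hk,
      ENNReal.ofReal_add zero_le_one (mul_nonneg (hnonneg k) hW0), ENNReal.ofReal_one]
  rw [hnorm]
  set L := ⨅ k ∈ Set.Ioi (0:ℝ), ENNReal.ofReal ((1 + φ k * W) / k)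
  have hL : ∀ k : ℝ, 0 < k → L ≤ ENNReal.ofReal ((1 + φ k * W) / k) := fun k hk =>
    iInf₂_le k hk
  have hLtop : L ≠ ⊤ := ne_top_of_le_ne_top ENNReal.ofReal_ne_top (hL 1 one_pos)
  have hLreal : ∀ k : ℝ, 0 < k → L.toReal ≤ (1 + φ k * W) / k := fun k hk =>
    ENNReal.toReal_le_of_le_ofReal
      (div_nonneg (add_nonneg zero_le_one (mul_nonneg (hnonneg k) hW0)) hk.le) (hL k hk)
  rcases hW0.eq_or_lt with hWz | hWpos
  · have hzero : L.toReal ≤ 0 := by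
      refine ge_of_tendsto tendsto_inv_atTop_zero ?_
      filter_upwards [eventually_gt_atTop (0:ℝ)] with k hk
      simpa [← hWz] using hLreal k hk
    rw [← ENNReal.ofReal_toReal hLtop, ENNReal.ofReal_of_nonpos hzero, ← hWz]
    simp
  · have hgreatest : IsGreatest {u : ℝ | 0 ≤ u ∧ complementaryFn φ u ≤ 1 / W}
        (L.toReal / W) := by
      refine ⟨⟨by positivity, ?_⟩, ?_⟩
      · rw [hφ.complementaryFn_le_iff (by positivity)]
        intro u hu
        have h := hLreal u hu
        rw [le_div_iff₀ hu] at h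
        rw [sub_le_iff_le_add, mul_div_assoc', div_add' _ _ _ hWpos.ne']
        gcongr
        linarith
      · rintro v ⟨hv, hle⟩
        rw [hφ.complementaryFn_le_iff hv] at hle
        rw [le_div_iff₀ hWpos]
        refine (ENNReal.ofReal_le_iff_le_toReal hLtop).1 (le_iInf₂ fun k hk => ?_)
        have hk' : 0 < k := hk
        refine ENNReal.ofReal_le_ofReal ?_
        have h := hle k hk'
        rw [le_div_iff₀ hWpos] at h
        rw [le_div_iff₀ hk']
        linarith
    rw [orliczInv, hgreatest.csSup_eq, div_mul_cancel₀ _ hWpos.ne', ENNReal.ofReal_toReal hLtop]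

end
end

section
/- Let x be in the Orlicz–Lorentz space Λ_{φ,ω} with ‖x‖°_{φ,ω} ≤ 1. Then ρ_{φ,ω}(x) ≤ ‖x‖°_{φ,ω}. -/
open MeasureTheory Set Filter Topology
open scoped ENNReal

noncomputable section

lemma ordConnected_domSet (γ : ℝ≥0∞) : (domSet γ).OrdConnected :=
  ⟨fun _ hx _ hy _ hz => ⟨hx.1.trans hz.1, (ENNReal.ofReal_le_ofReal hz.2).trans_lt hy.2⟩⟩

lemma rearr_nonneg (D : Set ℝ) (x : ℝ → ℝ) (t : ℝ) : 0 ≤ rearr D x t :=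
  Real.sInf_nonneg fun _ h => h.1.le

lemma rearr_const_mul (D : Set ℝ) (x : ℝ → ℝ) {k : ℝ} (hk : 0 < k) (t : ℝ) :
    rearr D (fun s => k * x s) t = k * rearr D x t := by
  unfold rearr
  rw [← smul_eq_mul, ← Real.sInf_smul_of_nonneg hk.le]
  congr 1
  ext θ
  rw [Set.mem_smul_set_iff_inv_smul_mem₀ hk.ne']
  simp only [Set.mem_ofPred_eq, smul_eq_mul]
  have h1 : 0 < k⁻¹ * θ ↔ 0 < θ := by
    rw [mul_pos_iff_of_pos_left (inv_pos.mpr hk)]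
  have h2 : ∀ s, k⁻¹ * θ < |x s| ↔ θ < |k * x s| := fun s => by
    rw [abs_mul, abs_of_pos hk, inv_mul_lt_iff₀ hk]
  simp only [h1, h2]

lemma measurable_rearr (D : Set ℝ) (x : ℝ → ℝ) : Measurable (rearr D x) := by
  refine measurable_of_Ioi fun a => ?_
  rcases lt_or_ge a 0 with ha | ha
  · convert MeasurableSet.univ
    exact Set.eq_univ_of_forall fun t => ha.trans_le (rearr_nonneg D x t)
  refine Set.OrdConnected.measurableSet ⟨fun t₁ h₁ t₂ h₂ t ht => ?_⟩
  simp only [Set.mem_preimage, Set.mem_Ioi] at h₁ h₂ ⊢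
  have hne : {θ : ℝ | 0 < θ ∧ volume {s ∈ D | θ < |x s|} ≤ ENNReal.ofReal t₁}.Nonempty := by
    by_contra h
    rw [Set.not_nonempty_iff_eq_empty] at h
    rw [rearr, h, Real.sInf_empty] at h₁
    exact h₁.not_ge ha
  refine h₂.trans_le (csInf_le_csInf ⟨0, fun _ h => h.1.le⟩ ?_ ?_)
  · exact hne.mono fun θ h => ⟨h.1, h.2.trans (ENNReal.ofReal_le_ofReal ht.1)⟩
  · exact fun θ h => ⟨h.1, h.2.trans (ENNReal.ofReal_le_ofReal ht.2)⟩

lemma IsOrliczFunction.continuous {φ : ℝ → ℝ} (hφ : IsOrliczFunction φ) : Continuous φ :=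
  continuousOn_univ.mp (hφ.1.continuousOn isOpen_univ)

lemma IsOrliczFunction.map_mul_le {φ : ℝ → ℝ} (hφ : IsOrliczFunction φ) {a : ℝ} (ha : 0 ≤ a)
    (ha1 : a ≤ 1) (u : ℝ) : φ (a * u) ≤ a * φ u := by
  have h := hφ.1.2 (Set.mem_univ u) (Set.mem_univ 0) ha (sub_nonneg.mpr ha1) (by ring)
  simpa [hφ.2.2.1] using h

lemma olModular_const_mul_le {γ : ℝ≥0∞} {φ ω : ℝ → ℝ} (hφ : IsOrliczFunction φ)
    (hω : IsWeight (domSet γ) ω) (x : ℝ → ℝ) {c k : ℝ} (hc : 0 < c) (hck : c ≤ k) :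
    olModular (domSet γ) φ ω (fun t => c * x t) ≤
      ENNReal.ofReal c *
        ((1 + olModular (domSet γ) φ ω (fun t => k * x t)) / ENNReal.ofReal k) := by
  have hk : 0 < k := hc.trans_le hck
  calc olModular (domSet γ) φ ω (fun t => c * x t)
      ≤ ENNReal.ofReal (c / k) * olModular (domSet γ) φ ω (fun t => k * x t) := by
        unfold olModular
        rw [← lintegral_const_mul' _ _ ENNReal.ofReal_ne_top]
        refine setLIntegral_mono' (ordConnected_domSet γ).measurableSet fun t ht => ?_
        rw [← ENNReal.ofReal_mul (by positivity), rearr_const_mul _ _ hc, rearr_const_mul _ _ hk,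
          ← mul_assoc]
        refine ENNReal.ofReal_le_ofReal (mul_le_mul_of_nonneg_right ?_ (hω.1 t ht))
        have h := hφ.map_mul_le (by positivity) ((div_le_one hk).mpr hck)
          (k * rearr (domSet γ) x t)
        rwa [← mul_assoc, div_mul_cancel₀ _ hk.ne'] at h
    _ = ENNReal.ofReal c *
          (olModular (domSet γ) φ ω (fun t => k * x t) / ENNReal.ofReal k) := by
        rw [ENNReal.ofReal_div_of_pos hk, div_eq_mul_inv, div_eq_mul_inv, mul_assoc, mul_comm _⁻¹]
    _ ≤ _ := by gcongr; exact le_add_self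

/-- Fatou property of the modular along dilations increasing to the identity. -/
lemma olModular_le_of_forall_lt_one {γ : ℝ≥0∞} {φ ω : ℝ → ℝ} (hφ : IsOrliczFunction φ)
    (hω : IsWeight (domSet γ) ω) (x : ℝ → ℝ) {M : ℝ≥0∞}
    (h : ∀ c : ℝ, 0 < c → c < 1 → olModular (domSet γ) φ ω (fun t => c * x t) ≤ M) :
    olModular (domSet γ) φ ω x ≤ M := by
  obtain ⟨c, -, hc, hlim⟩ := exists_seq_strictMono_tendsto' (zero_lt_one (α := ℝ))
  have hmeas : AEMeasurable ω (volume.restrict (domSet γ)) :=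
    aemeasurable_restrict_of_antitoneOn (ordConnected_domSet γ).measurableSet hω.2.1
  have hpt : ∀ t, Tendsto (fun n => ENNReal.ofReal (φ (c n * rearr (domSet γ) x t) * ω t)) atTop
      (𝓝 (ENNReal.ofReal (φ (rearr (domSet γ) x t) * ω t))) := fun t => by
    refine ENNReal.tendsto_ofReal (Tendsto.mul_const _ ?_)
    have h1 := (hφ.continuous.tendsto _).comp (hlim.mul_const (rearr (domSet γ) x t))
    rwa [one_mul] at h1
  calc olModular (domSet γ) φ ω x
      = ∫⁻ t in domSet γ,
          liminf (fun n => ENNReal.ofReal (φ (c n * rearr (domSet γ) x t) * ω t)) atTop :=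
        lintegral_congr fun t => (hpt t).liminf_eq.symm
    _ ≤ liminf (fun n => ∫⁻ t in domSet γ,
          ENNReal.ofReal (φ (c n * rearr (domSet γ) x t) * ω t)) atTop :=
        lintegral_liminf_le' fun n => ((hφ.continuous.measurable.comp
          ((measurable_rearr _ x).const_mul (c n))).aemeasurable.mul hmeas).ennreal_ofReal
    _ ≤ M := by
        refine liminf_le_of_frequently_le' (Frequently.of_forall fun n => ?_)
        simpa only [olModular, rearr_const_mul _ _ (hc n).1] using h (c n) (hc n).1 (hc n).2

lemma olModular_le_one_of_orliczNorm_le_one {γ : ℝ≥0∞} {φ ω : ℝ → ℝ} (hφ : IsOrliczFunction φ)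
    (hω : IsWeight (domSet γ) ω) {x : ℝ → ℝ} (hx : orliczNorm (domSet γ) φ ω x ≤ 1) :
    olModular (domSet γ) φ ω x ≤ 1 := by
  refine olModular_le_of_forall_lt_one hφ hω x fun c hc hc1 => ?_
  have hlt : orliczNorm (domSet γ) φ ω x < (ENNReal.ofReal c)⁻¹ := by
    refine hx.trans_lt (ENNReal.one_lt_inv.mpr ?_)
    simpa using hc1
  simp only [orliczNorm, iInf_lt_iff] at hlt
  obtain ⟨k, hk, hlt⟩ := hlt
  have hck : c ≤ k := by
    have h1 : (ENNReal.ofReal k)⁻¹ < (ENNReal.ofReal c)⁻¹ := by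
      refine lt_of_le_of_lt ?_ hlt
      rw [← one_div]
      gcongr
      exact le_self_add
    rw [ENNReal.inv_lt_inv] at h1
    exact (ENNReal.ofReal_lt_ofReal_iff hk).mp h1 |>.le
  calc olModular (domSet γ) φ ω (fun t => c * x t)
      ≤ _ := olModular_const_mul_le hφ hω x hc hck
    _ ≤ ENNReal.ofReal c * (ENNReal.ofReal c)⁻¹ := by gcongr
    _ ≤ 1 := ENNReal.mul_inv_le_one _

/-- If `x ∈ Λ_{φ,ω}` and `‖x‖°_{φ,ω} ≤ 1`, then
`ρ_{φ,ω}(x) ≤ ‖x‖°_{φ,ω}`. -/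
theorem modular_le_orliczNorm_of_norm_le_one
    (γ : ℝ≥0∞) (hγ : 0 < γ) (φ ω : ℝ → ℝ)
    (hφ : IsOrliczFunction φ) (hω : IsWeight (domSet γ) ω)
    (x : ℝ → ℝ) (hx : MemOL (domSet γ) φ ω x)
    (hxn : orliczNorm (domSet γ) φ ω x ≤ 1) :
    olModular (domSet γ) φ ω x ≤ orliczNorm (domSet γ) φ ω x := by
  refine le_iInf₂ fun k hk => ?_
  rcases le_total 1 k with h1 | h1
  · simpa using olModular_const_mul_le hφ hω x one_pos h1
  · refine (olModular_le_one_of_orliczNorm_le_one hφ hω hxn).trans ?_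
    calc (1 : ℝ≥0∞) ≤ 1 / ENNReal.ofReal k := by
          rw [one_div, ENNReal.one_le_inv]
          simpa using h1
      _ ≤ _ := by gcongr; exact le_self_add
end
end
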